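/- There exists ε > 0 such that for every real z with |z| < ε, the series Σ_{m ≥ 1} (Σ_{t ∈ I_m} 4^{−o(t)}) z^m / m! converges and its sum equals (e^{z/√2} − 1) / (2·((1/√2 − 1)e^{z/√2} + 1/√2 + 1)). Consequently, the probability p_n that two ranked trees of size n generated independently by the coalescent process are identical, namely p_n = Σ_{t ∈ I_{n−1}} 4^{n−1−o(t)} / ((n−1)!)², equals (4^{n−1}/(n−1)!) times the (n−1)-st Taylor coefficient at z = 0 of this function. -/

import Mathlib

/-- A 0-1-2-increasing tree of size `m`: vertices are `Fin m` (index `i`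
represents label `i+1`, so index `0` is the root labelled `1`), encoded by a
parent function `f` with `f i < i` for every non-root vertex `i`
(and `f 0 = 0` by convention), such that every vertex has at most 2 children. -/
abbrev IncTree (m : ℕ) : Type :=
  {f : Fin m → Fin m //
    (∀ i : Fin m, i.val = 0 → f i = i) ∧
    (∀ i : Fin m, i.val ≠ 0 → (f i).val < i.val) ∧
    (∀ j : Fin m, (Finset.univ.filter (fun i : Fin m => i.val ≠ 0 ∧ f i = j)).card ≤ 2)}

/-- The number of children of the vertex `j` in the tree `t`. -/
def numChildren {m : ℕ} (t : IncTree m) (j : Fin m) : ℕ :=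
  (Finset.univ.filter (fun i : Fin m => i.val ≠ 0 ∧ t.val i = j)).card

/-- `o t`: the number of leaves (outdegree-0 vertices) of `t`. -/
def numLeaves {m : ℕ} (t : IncTree m) : ℕ :=
  (Finset.univ.filter (fun j : Fin m => numChildren t j = 0)).card

open Real

/-- The closed form of `Y(1/4, z)`. -/
noncomputable def Yquarter (z : ℝ) : ℝ :=
  (Real.exp (z / Real.sqrt 2) - 1) /
    (2 * ((1 / Real.sqrt 2 - 1) * Real.exp (z / Real.sqrt 2)
      + 1 / Real.sqrt 2 + 1))

/-- Recursive trees on `m+1` vertices. -/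
abbrev RT (m : ℕ) : Type := ∀ i : Fin m, Fin (i.val + 1)

/-- number of children of vertex `j`. -/
def rc {m : ℕ} (g : RT m) (j : ℕ) : ℕ := ∑ i : Fin m, if (g i).val = j then 1 else 0

/-- total weight. -/
noncomputable def Wt (w : ℕ → ℝ) (m : ℕ) : ℝ := ∑ g : RT m, ∏ j : Fin (m + 1), w (rc g j.val)

/-- vertex weight by outdegree. -/
def ww (x y : ℝ) : ℕ → ℝ
  | 0 => x
  | 1 => y
  | 2 => 1
  | _ + 3 => 0

lemma rc_lt {m : ℕ} (g : RT m) (j : ℕ) (hj : m ≤ j) : rc g j = 0 := by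
  unfold rc
  apply Finset.sum_eq_zero
  intro i _
  have := (g i).isLt
  have := i.isLt
  rw [if_neg (by omega)]

lemma rc_snoc {m : ℕ} (p : Fin (m + 1) × RT m) (j : ℕ) :
    rc (Fin.snocEquiv (fun i : Fin (m + 1) => Fin (i.val + 1)) p : RT (m + 1)) j
      = rc p.2 j + if p.1.val = j then 1 else 0 := by
  unfold rc
  rw [Fin.sum_univ_castSucc]
  simp [Fin.snocEquiv]

lemma Wt_succ (w : ℕ → ℝ) (m : ℕ) :
    Wt w (m + 1) = ∑ g : RT m, ∑ k : Fin (m + 1),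
      (∏ j ∈ Finset.univ.erase k, w (rc g j.val)) * (w 0 * w (rc g k.val + 1)) := by
  unfold Wt
  rw [← Equiv.sum_comp (Fin.snocEquiv (fun i : Fin (m + 1) => Fin (i.val + 1)))]
  rw [Fintype.sum_prod_type, Finset.sum_comm]
  refine Finset.sum_congr rfl fun (g : RT m) _ =>
    Finset.sum_congr rfl fun (k : Fin (m + 1)) _ => ?_
  rw [Fin.prod_univ_castSucc]
  have h1 : rc (Fin.snocEquiv (fun i : Fin (m + 1) => Fin (i.val + 1)) (k, g) : RT (m + 1))
      (Fin.last (m + 1)).val = 0 := rc_lt _ _ (by simp)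
  rw [h1, ← Finset.mul_prod_erase Finset.univ _ (Finset.mem_univ k)]
  have h2 : ∏ j ∈ Finset.univ.erase k,
      w (rc (Fin.snocEquiv (fun i : Fin (m + 1) => Fin (i.val + 1)) (k, g) : RT (m + 1))
        (j.castSucc).val) = ∏ j ∈ Finset.univ.erase k, w (rc g j.val) := by
    refine Finset.prod_congr rfl fun j hj => ?_
    rw [rc_snoc]
    have : k.val ≠ j.val := fun h => (Finset.ne_of_mem_erase hj) (Fin.ext h.symm)
    simp [this]
  rw [h2, rc_snoc]
  simp
  ring

lemma hasDerivAt_ww {x y : ℝ → ℝ} {z : ℝ} (hx : HasDerivAt x (x z * y z) z)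
    (hy : HasDerivAt y (x z) z) (n : ℕ) :
    HasDerivAt (fun s => ww (x s) (y s) n) (ww (x z) (y z) 0 * ww (x z) (y z) (n + 1)) z := by
  match n with
  | 0 => simpa [ww] using hx
  | 1 => simpa [ww] using hy
  | 2 => simpa [ww] using hasDerivAt_const z (1 : ℝ)
  | n + 3 => simpa [ww] using hasDerivAt_const z (0 : ℝ)

lemma hasDerivAt_Wt {x y : ℝ → ℝ} {z : ℝ} (hx : HasDerivAt x (x z * y z) z)
    (hy : HasDerivAt y (x z) z) (m : ℕ) :
    HasDerivAt (fun s => Wt (ww (x s) (y s)) m) (Wt (ww (x z) (y z)) (m + 1)) z := by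
  rw [Wt_succ]
  unfold Wt
  refine HasDerivAt.fun_sum fun g _ => ?_
  have := HasDerivAt.fun_finsetProd (u := (Finset.univ : Finset (Fin (m + 1))))
    (f := fun j s => ww (x s) (y s) (rc g j.val))
    (fun j _ => hasDerivAt_ww hx hy (rc g j.val))
  simpa [smul_eq_mul] using this

lemma Wt_zero (w : ℕ → ℝ) : Wt w 0 = w 0 := by
  simp [Wt, rc]

/-- forget. -/
def toRT {m : ℕ} (t : IncTree (m + 1)) : RT m :=
  fun i => ⟨(t.val i.succ).val, by simpa using t.2.2.1 i.succ (by simp)⟩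

lemma card_eq_aux {m : ℕ} (f : Fin (m + 1) → Fin (m + 1)) (j : Fin (m + 1)) :
    (Finset.univ.filter (fun i : Fin (m + 1) => i.val ≠ 0 ∧ f i = j)).card
      = ∑ i : Fin m, if (f i.succ).val = j.val then 1 else 0 := by
  rw [Finset.card_filter, Fin.sum_univ_succ]
  simp [Fin.ext_iff]

lemma numChildren_eq {m : ℕ} (t : IncTree (m + 1)) (j : Fin (m + 1)) :
    numChildren t j = rc (toRT t) j.val := by
  unfold numChildren
  rw [card_eq_aux]
  rfl

lemma toRT_injective {m : ℕ} : Function.Injective (toRT : IncTree (m + 1) → RT m) := by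
  intro s t h
  apply Subtype.ext
  funext i
  refine Fin.cases ?_ (fun i => ?_) i
  · rw [s.2.1 0 rfl, t.2.1 0 rfl]
  · have := congrArg Fin.val (congrFun h i)
    exact Fin.ext this

lemma toRT_surj {m : ℕ} (g : RT m) (hg : ∀ j : Fin (m + 1), rc g j.val ≤ 2) :
    ∃ t : IncTree (m + 1), toRT t = g := by
  let f : Fin (m + 1) → Fin (m + 1) :=
    Fin.cases 0 (fun i => ⟨(g i).val, by have := (g i).isLt; have := i.isLt; omega⟩)
  refine ⟨⟨f, ?_, ?_, ?_⟩, ?_⟩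
  · intro i hi
    have : i = 0 := Fin.ext hi
    subst this
    rfl
  · intro i
    refine Fin.cases ?_ (fun i => ?_) i
    · intro h
      exact absurd rfl h
    · intro _
      have := (g i).isLt
      simpa [f] using this
  · intro j
    rw [card_eq_aux]
    exact hg j
  · funext i
    rfl

lemma sum_eq_Wt (m : ℕ) :
    ∑ t : IncTree (m + 1), (4 : ℝ) ^ (-(numLeaves t : ℤ)) = Wt (ww (1 / 4) 1) m := by
  unfold Wt
  refine Finset.sum_of_injOn toRT toRT_injective.injOn (by simp) ?_ ?_
  · intro g _ hg
    have : ∃ j : Fin (m + 1), 2 < rc g j.val := by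
      by_contra! h
      obtain ⟨t, ht⟩ := toRT_surj g h
      exact hg ⟨t, by simp, ht⟩
    obtain ⟨j, hj⟩ := this
    apply Finset.prod_eq_zero (Finset.mem_univ j)
    obtain ⟨k, hk⟩ := Nat.exists_eq_add_of_le hj
    rw [hk, show 3 + k = k + 3 by omega] at *
    rfl
  · intro t _
    have : ∀ j : Fin (m + 1), ww (1 / 4) 1 (rc (toRT t) j.val) =
        if numChildren t j = 0 then 1 / 4 else 1 := by
      intro j
      have h2 : numChildren t j ≤ 2 := t.2.2.2 j
      rw [← numChildren_eq]
      interval_cases numChildren t j <;> simp [ww]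
    rw [Finset.prod_congr rfl fun j _ => this j, Finset.prod_ite]
    simp [numLeaves]

/-- denominator -/
noncomputable def Dn (z : ℝ) : ℝ :=
  (1 / Real.sqrt 2 - 1) * Real.exp (z / Real.sqrt 2) + 1 / Real.sqrt 2 + 1

lemma Dn_zero : Dn 0 ≠ 0 := by
  have : 0 < Real.sqrt 2 := by positivity
  have h2 : 0 < (Real.sqrt 2)⁻¹ := by positivity
  simp [Dn]
  intro h
  linarith

lemma Dn_ev : ∀ᶠ z in nhds (0 : ℝ), Dn z ≠ 0 := by
  have : ContinuousAt Dn 0 := by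
    unfold Dn
    fun_prop
  exact this.eventually_ne Dn_zero

lemma hasDerivAt_Y {z : ℝ} (hz : Dn z ≠ 0) :
    HasDerivAt Yquarter (1 / 4 + Yquarter z + Yquarter z ^ 2 / 2) z := by
  have he : HasDerivAt (fun z : ℝ => Real.exp (z / Real.sqrt 2))
      (Real.exp (z / Real.sqrt 2) * (1 / Real.sqrt 2)) z :=
    ((hasDerivAt_id z).div_const _).exp
  have hD : HasDerivAt (fun z : ℝ => 2 * ((1 / Real.sqrt 2 - 1) * Real.exp (z / Real.sqrt 2)
      + 1 / Real.sqrt 2 + 1))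
      (2 * ((1 / Real.sqrt 2 - 1) * (Real.exp (z / Real.sqrt 2) * (1 / Real.sqrt 2)))) z :=
    (((he.const_mul _).add_const _).add_const _).const_mul 2
  have h := (he.sub_const 1).fun_div hD (mul_ne_zero two_ne_zero hz)
  refine h.congr_deriv ?_
  unfold Yquarter
  unfold Dn at hz
  generalize Real.exp (z / Real.sqrt 2) = E at *
  have ha : (1 / Real.sqrt 2) ^ 2 = 1 / 2 := by
    rw [div_pow, Real.sq_sqrt (by norm_num)]
    norm_num
  generalize 1 / Real.sqrt 2 = a at *
  obtain ⟨D, hDe⟩ : ∃ D, D = (a - 1) * E + a + 1 := ⟨_, rfl⟩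
  rw [← hDe] at hz ⊢
  have e1 : E * a * (2 * D) - (E - 1) * (2 * ((a - 1) * (E * a))) = 4 * a ^ 2 * E := by
    rw [hDe]
    ring
  have e2 : 2 * D ^ 2 + 4 * D * (E - 1) + (E - 1) ^ 2 = 8 * a ^ 2 * E := by
    rw [hDe]
    linear_combination 2 * (E - 1) ^ 2 * ha
  have e3 : 1 / 4 + (E - 1) / (2 * D) + ((E - 1) / (2 * D)) ^ 2 / 2 =
      (2 * D ^ 2 + 4 * D * (E - 1) + (E - 1) ^ 2) / (8 * D ^ 2) := by
    field_simp
    ring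
  rw [e1, e3, e2]
  field_simp
  ring

lemma iter_Y (m : ℕ) : iteratedDeriv (m + 1) Yquarter =ᶠ[nhds 0]
    fun z => Wt (ww (1 / 4 + Yquarter z + Yquarter z ^ 2 / 2) (1 + Yquarter z)) m := by
  induction m with
  | zero =>
    filter_upwards [Dn_ev] with z hz
    rw [zero_add, iteratedDeriv_one, Wt_zero, (hasDerivAt_Y hz).deriv]
    rfl
  | succ m ih =>
    have := ih.deriv
    rw [← iteratedDeriv_succ] at this
    filter_upwards [this, Dn_ev] with z h1 hz
    rw [h1]
    have hY := hasDerivAt_Y hz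
    refine (hasDerivAt_Wt (x := fun z => 1 / 4 + Yquarter z + Yquarter z ^ 2 / 2)
      (y := fun z => 1 + Yquarter z) ?_ (hY.const_add 1) m).deriv
    refine ((hY.const_add (1 / 4)).fun_add ((hY.fun_pow 2).div_const 2)).congr_deriv ?_
    simp
    ring

lemma Y_zero : Yquarter 0 = 0 := by simp [Yquarter]

lemma iter_Y_zero (m : ℕ) : iteratedDeriv (m + 1) Yquarter 0 =
    ∑ t : IncTree (m + 1), (4 : ℝ) ^ (-(numLeaves t : ℤ)) := by
  rw [(iter_Y m).eq_of_nhds, sum_eq_Wt, Y_zero]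
  norm_num

lemma Y_analytic : AnalyticAt ℝ Yquarter 0 := by
  have h := Dn_zero
  unfold Dn at h
  unfold Yquarter
  have he : AnalyticAt ℝ (fun z : ℝ => Real.exp (z / Real.sqrt 2)) 0 := by fun_prop
  exact (he.fun_sub analyticAt_const).fun_div (analyticAt_const.fun_mul
    (((analyticAt_const.fun_mul he).fun_add analyticAt_const).fun_add analyticAt_const))
    (mul_ne_zero two_ne_zero h)

/-- For `z` small enough, `Σ_{m ≥ 1} (Σ_{t ∈ I_m} 4^{−o t}) z^m / m!`
converges to `Yquarter z`; consequently the probability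
`p_n = Σ_{t ∈ I_{n−1}} 4^{n−1−o t} / ((n−1)!)²` that two independently
coalescent-generated ranked trees of size `n` coincide equals
`(4^{n−1}/(n−1)!)` times the `(n−1)`-st Taylor coefficient of `Yquarter`
at `0`. -/
theorem prob_identical_ranked_trees :
    (∃ ε > 0, ∀ z : ℝ, |z| < ε →
      HasSum (fun m : ℕ =>
          (∑ t : IncTree (m + 1), (4 : ℝ) ^ (-(numLeaves t : ℤ)))
            * z ^ (m + 1) / (Nat.factorial (m + 1)))
        (Yquarter z)) ∧
    ∀ n : ℕ, 2 ≤ n →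
      (∑ t : IncTree (n - 1), (4 : ℝ) ^ (n - 1 - numLeaves t)) /
          ((Nat.factorial (n - 1) : ℝ)) ^ 2 =
        4 ^ (n - 1) / (Nat.factorial (n - 1)) *
          (iteratedDeriv (n - 1) Yquarter 0 / (Nat.factorial (n - 1))) := by
  constructor
  · have h := Y_analytic.hasFPowerSeriesAt.eventually_hasSum
    obtain ⟨ε, hε, h⟩ := Metric.eventually_nhds_iff.1 h
    refine ⟨ε, hε, fun z hz => ?_⟩
    have h1 := h (y := z) (by simpa using hz)
    rw [zero_add, ← hasSum_nat_add_iff' 1] at h1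
    simp only [Finset.sum_range_one, FormalMultilinearSeries.ofScalars_apply_eq,
      iteratedDeriv_zero, Y_zero, zero_div, zero_mul, sub_zero, smul_eq_mul,
      iter_Y_zero] at h1
    have h2 : (fun m : ℕ => (∑ t : IncTree (m + 1), (4 : ℝ) ^ (-(numLeaves t : ℤ)))
        * z ^ (m + 1) / (Nat.factorial (m + 1))) =
        fun m : ℕ => (∑ t : IncTree (m + 1), (4 : ℝ) ^ (-(numLeaves t : ℤ)))
        / (Nat.factorial (m + 1)) * z ^ (m + 1) := by
      funext m
      ring
    rw [h2]
    exact h1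
  · intro n hn
    obtain ⟨m, rfl⟩ : ∃ m, n = m + 2 := ⟨n - 2, by omega⟩
    have hm : m + 2 - 1 = m + 1 := by omega
    rw [hm, iter_Y_zero]
    have : ∑ t : IncTree (m + 1), (4 : ℝ) ^ (m + 1 - numLeaves t) =
        4 ^ (m + 1) * ∑ t : IncTree (m + 1), (4 : ℝ) ^ (-(numLeaves t : ℤ)) := by
      rw [Finset.mul_sum]
      refine Finset.sum_congr rfl fun t _ => ?_
      have hl : numLeaves t ≤ m + 1 := by
        unfold numLeaves
        exact (Finset.card_le_univ _).trans (by simp)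
      rw [pow_sub₀ _ (by norm_num) hl, zpow_neg, zpow_natCast]
    rw [this]
    ring
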